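/- arXiv:2508.18656 — 3 statements merged into one kernel-verified Lean document; each statement's English description precedes it below -/
import Mathlib

section
/- Let D be a finite-dimensional linear subspace of ℓ^∞ with D ∩ c = {0}, and let E be a separable real Banach space. Then there exists a closed linear subspace Z of ℓ^∞ such that D ⊆ Z, Z contains a linear subspace isometrically isomorphic to E, and Z ∩ c = {0}. -/
open Filter Topology

noncomputable section

/-- `ℓ^∞`: the Banach space of bounded real sequences with the sup norm. -/
abbrev Linfty : Type := lp (fun _ : ℕ => ℝ) ⊤

/-- `c`: the set of convergent sequences inside `ℓ^∞`. -/
def convSeq : Set Linfty := {f | ∃ l : ℝ, Tendsto (fun n => (f : ℕ → ℝ) n) atTop (𝓝 l)}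

theorem exists_subseq_tendsto_of_finiteDimensional (D : Submodule ℝ Linfty)
    [FiniteDimensional ℝ D] :
    ∃ φ : ℕ → ℕ, StrictMono φ ∧
      ∀ d ∈ D, ∃ l : ℝ, Tendsto (fun n => (d : ℕ → ℝ) (φ n)) atTop (𝓝 l) := by
  let ev : ℕ → StrongDual ℝ D := fun n =>
    ((lp.evalCLM ℝ (fun _ : ℕ => ℝ) ⊤ n).comp D.subtypeL : D →L[ℝ] ℝ)
  have hev : ∀ n, ev n ∈ Metric.closedBall (0 : StrongDual ℝ D) 1 := fun n => by
    refine (mem_closedBall_zero_iff (E := StrongDual ℝ D)).2 ?_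
    refine ContinuousLinearMap.opNorm_le_bound _ zero_le_one fun d => ?_
    rw [one_mul]
    exact lp.norm_apply_le_norm ENNReal.top_ne_zero (d : Linfty) n
  have : ProperSpace (StrongDual ℝ D) := FiniteDimensional.proper ℝ (StrongDual ℝ D)
  obtain ⟨g, -, φ, hφ, hg⟩ := tendsto_subseq_of_bounded Metric.isBounded_closedBall hev
  refine ⟨φ, hφ, fun d hd => ⟨g ⟨d, hd⟩, ?_⟩⟩
  exact ((ContinuousLinearMap.apply ℝ ℝ (⟨d, hd⟩ : D)).continuous.tendsto g).comp hg

theorem exists_norming_sequence (E : Type*) [NormedAddCommGroup E] [NormedSpace ℝ E]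
    [TopologicalSpace.SeparableSpace E] :
    ∃ f : ℕ → StrongDual ℝ E, (∀ k, ‖f k‖ ≤ 1) ∧
      ∀ x : E, ∀ C : ℝ, (∀ k, |f k x| ≤ C) → ‖x‖ ≤ C := by
  choose f hf hfu using fun k =>
    exists_dual_vector'' ℝ (TopologicalSpace.denseSeq E k)
  refine ⟨f, hf, fun x C hC => le_of_forall_pos_le_add fun ε hε => ?_⟩
  obtain ⟨k, hk⟩ := (TopologicalSpace.denseRange_denseSeq E).exists_dist_lt x (half_pos hε)
  set u := TopologicalSpace.denseSeq E k
  rw [dist_eq_norm] at hk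
  have h₁ : |f k (x - u)| ≤ ‖x - u‖ := (f k).le_of_opNorm_le_of_le (hf k) le_rfl |>.trans_eq
    (one_mul _)
  have h₂ : f k u = ‖u‖ := hfu k
  have h₃ : ‖x‖ ≤ ‖x - u‖ + ‖u‖ := by simpa using norm_add_le (x - u) u
  have h₄ := hC k
  rw [map_sub] at h₁
  rw [abs_le] at h₁ h₄
  linarith

/-- The isometric embedding into `ℓ^∞` given by a norming sequence of functionals. -/
def normingEmbedding {E : Type*} [NormedAddCommGroup E] [NormedSpace ℝ E]
    (a : ℕ → StrongDual ℝ E) (ha : ∀ n, ‖a n‖ ≤ 1)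
    (hn : ∀ x : E, ∀ C : ℝ, (∀ n, |a n x| ≤ C) → ‖x‖ ≤ C) : E →ₗᵢ[ℝ] Linfty :=
  have hle : ∀ x n, ‖a n x‖ ≤ ‖x‖ := fun x n => by
    simpa using (a n).le_of_opNorm_le (ha n) x
  { toFun := fun x => ⟨fun n => a n x, memℓp_infty ⟨‖x‖, by
      rintro _ ⟨n, rfl⟩
      exact hle x n⟩⟩
    map_add' := fun x y => by ext n; exact map_add (a n) x y
    map_smul' := fun r x => by ext n; exact map_smul (a n) r x
    norm_map' := fun x => le_antisymm
      (lp.norm_le_of_forall_le (norm_nonneg x) (hle x))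
      (hn x _ fun n => lp.norm_apply_le_norm ENNReal.top_ne_zero
        (⟨fun n => a n x, _⟩ : Linfty) n) }

theorem normingEmbedding_apply {E : Type*} [NormedAddCommGroup E] [NormedSpace ℝ E]
    (a : ℕ → StrongDual ℝ E) (ha : ∀ n, ‖a n‖ ≤ 1)
    (hn : ∀ x : E, ∀ C : ℝ, (∀ n, |a n x| ≤ C) → ‖x‖ ≤ C) (x : E) (n : ℕ) :
    (normingEmbedding a ha hn x : ℕ → ℝ) n = a n x :=
  rfl

theorem eq_zero_of_tendsto_neg_one_pow_mul {c l : ℝ}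
    (h : Tendsto (fun i : ℕ => (-1 : ℝ) ^ i * c) atTop (𝓝 l)) : c = 0 := by
  have h₁ : Tendsto (fun i : ℕ => (-1 : ℝ) ^ (i + 1) * c) atTop (𝓝 (-l)) :=
    h.neg.congr fun i => by ring
  have hl : l = -l := tendsto_nhds_unique ((tendsto_add_atTop_iff_nat 1).2 h) h₁
  have hl0 : l = 0 := by linarith
  have h₂ := h.abs
  simp only [abs_mul, abs_pow, abs_neg, abs_one, one_pow, one_mul, hl0, abs_zero] at h₂
  exact abs_eq_zero.1 (tendsto_nhds_unique tendsto_const_nhds h₂)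

/-- If every element of `D` converges along `φ`, there is an isometric copy of `E` such that
no nonzero element of it can be moved into `c` by adding an element of `D`. -/
theorem exists_linearIsometry_eq_zero_of_add_mem_convSeq (D : Submodule ℝ Linfty)
    [FiniteDimensional ℝ D] (E : Type*) [NormedAddCommGroup E] [NormedSpace ℝ E]
    [TopologicalSpace.SeparableSpace E] :
    ∃ T : E →ₗᵢ[ℝ] Linfty, ∀ d ∈ D, ∀ x : E, d + T x ∈ convSeq → x = 0 := by
  obtain ⟨φ, hφ, hD⟩ := exists_subseq_tendsto_of_finiteDimensional D
  obtain ⟨f, hf, hfn⟩ := exists_norming_sequence E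
  let a : ℕ → StrongDual ℝ E := fun n =>
    (-1 : ℝ) ^ (Function.invFun φ n).unpair.2 • f (Function.invFun φ n).unpair.1
  have ha : ∀ n, ‖a n‖ ≤ 1 := fun n => by
    simpa [a, norm_smul] using hf _
  have hap : ∀ k i x, a (φ (Nat.pair k i)) x = (-1 : ℝ) ^ i * f k x := fun k i x => by
    simp [a, Function.leftInverse_invFun hφ.injective (Nat.pair k i)]
  have hn : ∀ x : E, ∀ C : ℝ, (∀ n, |a n x| ≤ C) → ‖x‖ ≤ C := fun x C hC =>
    hfn x C fun k => by simpa [hap] using hC (φ (Nat.pair k 0))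
  refine ⟨normingEmbedding a ha hn, fun d hd x ⟨l, hl⟩ => ?_⟩
  obtain ⟨m, hm⟩ := hD d hd
  have hfx : ∀ k, f k x = 0 := fun k => by
    have hpair : Tendsto (Nat.pair k) atTop atTop :=
      StrictMono.tendsto_atTop fun _ _ h => Nat.pair_lt_pair_right k h
    refine eq_zero_of_tendsto_neg_one_pow_mul (l := l - m) ?_
    refine (((hl.comp hφ.tendsto_atTop).comp hpair).sub (hm.comp hpair)).congr fun i => ?_
    simp [normingEmbedding_apply, hap]
  exact norm_le_zero_iff.1 (hfn x 0 fun k => by simp [hfx k])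

/-- Finite-dimensional extension: any finite-dimensional `D ⊆ ℓ^∞` with `D ∩ c = {0}`
extends to a closed subspace `Z` containing an isometric copy of any separable Banach
space `E`, with `Z ∩ c = {0}`. -/
theorem stmt2 (D : Submodule ℝ Linfty) (hDfin : FiniteDimensional ℝ D)
    (hDc : (D : Set Linfty) ∩ convSeq = {0})
    (E : Type*) [NormedAddCommGroup E] [NormedSpace ℝ E] [CompleteSpace E]
    [TopologicalSpace.SeparableSpace E] :
    ∃ Z : Submodule ℝ Linfty, IsClosed (Z : Set Linfty) ∧ D ≤ Z ∧
      (∃ F : Submodule ℝ Linfty, F ≤ Z ∧ Nonempty (E ≃ₗᵢ[ℝ] F)) ∧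
      (Z : Set Linfty) ∩ convSeq = {0} := by
  obtain ⟨T, hT⟩ := exists_linearIsometry_eq_zero_of_add_mem_convSeq D E
  have hcl : IsClosed ((LinearMap.range T.toLinearMap : Submodule ℝ Linfty) : Set Linfty) := by
    rw [LinearMap.coe_range]
    exact T.isometry.isClosedEmbedding.isClosed_range
  refine ⟨LinearMap.range T.toLinearMap ⊔ D, ?_, le_sup_right,
    ⟨LinearMap.range T.toLinearMap, le_sup_left, ⟨T.equivRange⟩⟩, ?_⟩
  · exact Submodule.isClosed_sup_finiteDimensional _ _ hcl
  · refine Set.Subset.antisymm ?_ ?_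
    · rintro z ⟨hz, hzc⟩
      obtain ⟨_, ⟨x, rfl⟩, d, hd, rfl⟩ := Submodule.mem_sup.1 hz
      have hx : x = 0 := hT d hd x (by rwa [add_comm] at hzc)
      subst hx
      rw [map_zero, zero_add] at hzc ⊢
      exact hDc.subset ⟨hd, hzc⟩
    · rintro _ rfl
      exact ⟨zero_mem _, (hDc.superset rfl).2⟩
end
end

section
/- Let D be a separable linear subspace of ℓ^∞ (i.e., D is separable in the supremum-norm topology) with D ∩ c = {0}, and let E be a separable real Banach space. Then there exists a linear isometry T : E → ℓ^∞ such that T(E) ∩ (D + c) = {0}. -/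
open Filter Topology

noncomputable section

section NormingFunctionals

variable {E : Type*} [NormedAddCommGroup E] [NormedSpace ℝ E]

/-- A separable normed space is normed by countably many functionals of norm at most one. -/
theorem exists_norming_seq (E : Type*) [NormedAddCommGroup E] [NormedSpace ℝ E]
    [TopologicalSpace.SeparableSpace E] :
    ∃ f : ℕ → StrongDual ℝ E, (∀ k, ‖f k‖ ≤ 1) ∧
      ∀ x r, (∀ k, |f k x| ≤ r) → ‖x‖ ≤ r := by
  choose g hg hgx using fun x : E => exists_dual_vector'' ℝ x
  refine ⟨fun k => g (TopologicalSpace.denseSeq E k), fun k => hg _, fun x r h => ?_⟩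
  refine le_of_forall_pos_le_add fun δ hδ => ?_
  obtain ⟨k, hk⟩ := (TopologicalSpace.denseRange_denseSeq E).exists_dist_lt x (half_pos hδ)
  set y := TopologicalSpace.denseSeq E k
  rw [dist_eq_norm] at hk
  have hxy : ‖x‖ ≤ ‖x - y‖ + ‖y‖ := by simpa using norm_add_le (x - y) y
  have hy : g y y = ‖y‖ := hgx y
  have hsub : |g y (x - y)| ≤ ‖x - y‖ := (g y).le_of_opNorm_le (hg y) (x - y) |>.trans (by simp)
  have hx := h k
  rw [map_sub] at hsub
  have h₁ := abs_le.1 hsub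
  have h₂ := abs_le.1 hx
  change _ ≤ g y x ∧ g y x ≤ r at h₂
  linarith

/-- The real sign attached to a Boolean. -/
def boolSign (b : Bool) : ℝ := if b then 1 else -1

theorem abs_boolSign (b : Bool) : |boolSign b| = 1 := by
  cases b <;> simp [boolSign]

theorem abs_boolSign_sub {a b : Bool} (h : a ≠ b) : |boolSign a - boolSign b| = 2 := by
  cases a <;> cases b <;> simp_all [boolSign] <;> norm_num

theorem memℓp_signed (f : ℕ → StrongDual ℝ E) (hf : ∀ k, ‖f k‖ ≤ 1) (ε : ℕ → Bool) (x : E) :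
    Memℓp (fun n : ℕ => boolSign (ε n.unpair.2) * f n.unpair.1 x) ⊤ := by
  refine memℓp_infty ⟨‖x‖, ?_⟩
  rintro _ ⟨n, rfl⟩
  simpa [abs_mul, abs_boolSign] using (f n.unpair.1).le_of_opNorm_le (hf _) x

/-- The isometric embedding into `ℓ^∞` given by countably many copies of a norming sequence of
functionals, the copy of index `m` being multiplied by the sign `ε m`. -/
def signedEmbedding (f : ℕ → StrongDual ℝ E) (hf : ∀ k, ‖f k‖ ≤ 1)
    (hnorm : ∀ x r, (∀ k, |f k x| ≤ r) → ‖x‖ ≤ r) (ε : ℕ → Bool) : E →ₗᵢ[ℝ] Linfty where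
  toFun x := ⟨_, memℓp_signed f hf ε x⟩
  map_add' x y := by
    ext n
    change _ * f _ (x + y) = _ * f _ x + _ * f _ y
    rw [map_add, mul_add]
  map_smul' a x := by
    ext n
    simp [mul_left_comm]
  norm_map' x := by
    refine le_antisymm (lp.norm_le_of_forall_le (norm_nonneg x) fun n => ?_)
      (hnorm x _ fun k => ?_)
    · simpa [abs_mul, abs_boolSign] using (f n.unpair.1).le_of_opNorm_le (hf _) x
    · simpa [abs_mul, abs_boolSign] using
        lp.norm_apply_le_norm ENNReal.top_ne_zero (⟨_, memℓp_signed f hf ε x⟩ : Linfty)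
          (Nat.pair k 0)

theorem two_mul_norm_le_norm_signedEmbedding_sub (f : ℕ → StrongDual ℝ E)
    (hf : ∀ k, ‖f k‖ ≤ 1) (hnorm : ∀ x r, (∀ k, |f k x| ≤ r) → ‖x‖ ≤ r)
    {ε δ : ℕ → Bool} (h : ε ≠ δ) (x : E) :
    2 * ‖x‖ ≤ ‖signedEmbedding f hf hnorm ε x - signedEmbedding f hf hnorm δ x‖ := by
  obtain ⟨m, hm⟩ := Function.ne_iff.1 h
  have key := hnorm x
    (‖signedEmbedding f hf hnorm ε x - signedEmbedding f hf hnorm δ x‖ / 2) fun k => by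
      have := lp.norm_apply_le_norm ENNReal.top_ne_zero
        (signedEmbedding f hf hnorm ε x - signedEmbedding f hf hnorm δ x) (Nat.pair k m)
      simp only [lp.coeFn_sub, Pi.sub_apply, signedEmbedding, LinearIsometry.coe_mk,
        LinearMap.coe_mk, AddHom.coe_mk, Nat.unpair_pair, ← sub_mul, norm_mul,
        Real.norm_eq_abs, abs_boolSign_sub hm] at this
      rw [le_div_iff₀ two_pos, mul_comm]
      exact this
  linarith

end NormingFunctionals

/-- In a separable subset of a metric space, no uncountable family is uniformly separated. -/
theorem TopologicalSpace.IsSeparable.exists_ne_dist_lt {X ι : Type*} [PseudoMetricSpace X]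
    [Uncountable ι] {s : Set X} (hs : TopologicalSpace.IsSeparable s) {u : ι → X}
    (hu : ∀ i, u i ∈ s) {r : ℝ} (hr : 0 < r) : ∃ i j, i ≠ j ∧ dist (u i) (u j) < r := by
  obtain ⟨t, ht, hst⟩ := hs
  choose v hvt hv using fun i => Metric.mem_closure_iff.1 (hst (hu i)) (r / 2) (half_pos hr)
  have := ht.to_subtype
  obtain ⟨i, j, hij, hne⟩ : ∃ i j, (⟨v i, hvt i⟩ : t) = ⟨v j, hvt j⟩ ∧ i ≠ j := by
    by_contra! hinj
    exact not_countable (α := ι)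
      (Function.Injective.countable (f := fun i => (⟨v i, hvt i⟩ : t)) fun i j => hinj i j)
  refine ⟨i, j, hne, ?_⟩
  have h₁ := hv i
  have h₂ := hv j
  rw [← Subtype.mk.inj hij, dist_comm] at h₂
  linarith [dist_triangle (u i) (v i) (u j)]

theorem isSeparable_convSeq : TopologicalSpace.IsSeparable convSeq := by
  let S : Set Linfty := insert 1 (Set.range fun n : ℕ => lp.single ⊤ n (1 : ℝ))
  have hS : TopologicalSpace.IsSeparable (Submodule.span ℝ S : Set Linfty) :=
    ((Set.countable_range _).insert _).isSeparable.span
  refine hS.closure.mono fun x ⟨l, hl⟩ => Metric.mem_closure_iff.2 fun r hr => ?_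
  obtain ⟨N, hN⟩ := Metric.tendsto_atTop.1 hl (r / 2) (half_pos hr)
  refine ⟨l • 1 + ∑ n ∈ Finset.range N, (x n - l) • lp.single ⊤ n (1 : ℝ), ?_, ?_⟩
  · refine add_mem (Submodule.smul_mem _ _ (Submodule.subset_span (Set.mem_insert _ _)))
      (sum_mem fun n _ => Submodule.smul_mem _ _ (Submodule.subset_span ?_))
    exact Set.mem_insert_of_mem _ ⟨n, rfl⟩
  · rw [dist_eq_norm]
    refine (lp.norm_le_of_forall_le (half_pos hr).le fun i => ?_).trans_lt (half_lt_self hr)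
    have heval : (l • 1 + ∑ n ∈ Finset.range N, (x n - l) • lp.single ⊤ n (1 : ℝ) : Linfty) i =
        l + ∑ n ∈ Finset.range N, if i = n then x n - l else 0 := by
      rw [lp.coeFn_add, lp.coeFn_sum]
      change l * 1 + (∑ n ∈ Finset.range N, ⇑((x n - l) • lp.single ⊤ n (1 : ℝ) : Linfty)) i = _
      rw [Finset.sum_apply, mul_one]
      refine congrArg _ (Finset.sum_congr rfl fun n _ => ?_)
      change (x n - l) * (Pi.single n (1 : ℝ) : ℕ → ℝ) i = _
      simp [Pi.single_apply]
    rw [lp.coeFn_sub, Pi.sub_apply, heval, Finset.sum_ite_eq]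
    by_cases h : i < N
    · simp [h, (half_pos hr).le]
    · simpa [h, Real.dist_eq] using (hN i (not_lt.1 h)).le

/-- A separable normed space embeds isometrically into `ℓ^∞` so that its image meets a given
separable set at most at the origin, provided the set is stable under scalars. -/
theorem exists_linearIsometry_notMem {E : Type*} [NormedAddCommGroup E] [NormedSpace ℝ E]
    [TopologicalSpace.SeparableSpace E] {M : Set Linfty} (hM : TopologicalSpace.IsSeparable M)
    (hsmul : ∀ (a : ℝ), ∀ z ∈ M, a • z ∈ M) :
    ∃ T : E →ₗᵢ[ℝ] Linfty, ∀ x, T x ∈ M → x = 0 := by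
  obtain ⟨f, hf, hnorm⟩ := exists_norming_seq E
  let T := signedEmbedding f hf hnorm
  by_contra! H
  have H' : ∀ ε, ∃ x, T ε x ∈ M ∧ ‖x‖ = 1 := fun ε => by
    obtain ⟨x, hx, hx0⟩ := H (T ε)
    exact ⟨‖x‖⁻¹ • x, by simpa using hsmul ‖x‖⁻¹ _ hx, norm_smul_inv_norm (𝕜 := ℝ) hx0⟩
  choose x hxM hx using H'
  have : Uncountable (ℕ → Bool) := by
    rw [← Cardinal.aleph0_lt_mk_iff]
    simpa using Cardinal.cantor Cardinal.aleph0
  obtain ⟨ε, δ, hne, hlt⟩ :=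
    ((TopologicalSpace.IsSeparable.of_separableSpace (Set.univ : Set E)).prod hM).exists_ne_dist_lt
      (u := fun ε => (x ε, T ε (x ε))) (fun ε => ⟨Set.mem_univ _, hxM ε⟩) one_pos
  rw [Prod.dist_eq, max_lt_iff, dist_eq_norm, dist_eq_norm] at hlt
  have hsep : 2 * ‖x ε‖ ≤ ‖T ε (x ε) - T δ (x ε)‖ :=
    two_mul_norm_le_norm_signedEmbedding_sub f hf hnorm hne (x ε)
  have htri := norm_sub_le_norm_sub_add_norm_sub (T ε (x ε)) (T δ (x δ)) (T δ (x ε))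
  rw [← map_sub, LinearIsometry.norm_map, norm_sub_rev (x δ)] at htri
  linarith [hx ε, hlt.1, hlt.2]

/-- Given a separable subspace `D ⊆ ℓ^∞` with `D ∩ c = {0}` and a separable Banach
space `E`, there is a linear isometry `T : E → ℓ^∞` with `T(E) ∩ (D + c) = {0}`. -/
theorem stmt6 (D : Submodule ℝ Linfty)
    (hDsep : TopologicalSpace.IsSeparable (D : Set Linfty))
    (hDc : (D : Set Linfty) ∩ convSeq = {0})
    (E : Type*) [NormedAddCommGroup E] [NormedSpace ℝ E] [CompleteSpace E]
    [TopologicalSpace.SeparableSpace E] :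
    ∃ T : E →ₗᵢ[ℝ] Linfty,
      Set.range T ∩ {z : Linfty | ∃ d ∈ D, ∃ y ∈ convSeq, z = d + y} = {0} := by
  have hsum : TopologicalSpace.IsSeparable {z : Linfty | ∃ d ∈ D, ∃ y ∈ convSeq, z = d + y} := by
    refine ((hDsep.prod isSeparable_convSeq).image continuous_add).mono ?_
    rintro _ ⟨d, hd, y, hy, rfl⟩
    exact ⟨(d, y), ⟨hd, hy⟩, rfl⟩
  obtain ⟨T, hT⟩ := exists_linearIsometry_notMem (E := E) hsum <| by
    rintro a _ ⟨d, hd, y, ⟨l, hl⟩, rfl⟩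
    exact ⟨a • d, D.smul_mem a hd, a • y, ⟨a * l, hl.const_mul a⟩, smul_add a d y⟩
  refine ⟨T, Set.Subset.antisymm ?_ ?_⟩
  · rintro _ ⟨⟨x, rfl⟩, hx⟩
    simp [hT x hx]
  · rintro _ rfl
    exact ⟨⟨0, map_zero T⟩, 0, D.zero_mem, 0, ⟨0, tendsto_const_nhds⟩, (add_zero 0).symm⟩
end
end

section
/- For every separable linear subspace D of ℓ^∞ with D ∩ c = {0}, there exists a (not necessarily closed) linear subspace Z of ℓ^∞ with D ⊆ Z, Z ∩ c = {0}, and the algebraic dimension of Z equal to the cardinality of the continuum 𝔠. -/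
open Filter Topology

noncomputable section

/-- The convergent sequences as a linear subspace of `ℓ^∞`. -/
def convSubmodule : Submodule ℝ Linfty where
  carrier := convSeq
  add_mem' := by
    rintro f g ⟨a, ha⟩ ⟨b, hb⟩
    exact ⟨a + b, ha.add hb⟩
  zero_mem' := ⟨0, tendsto_const_nhds⟩
  smul_mem' := by
    rintro r f ⟨a, ha⟩
    exact ⟨r * a, ha.const_mul r⟩

/-- The bounded sequence taking the value `t ^ i * (-1) ^ k` at the index coding `(i, k)`. -/
def oscillatingGeometric (t : Set.Ioo (0 : ℝ) 1) : Linfty :=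
  ⟨fun n => (t : ℝ) ^ n.unpair.1 * (-1) ^ n.unpair.2, by
    refine memℓp_infty ⟨1, ?_⟩
    rintro _ ⟨n, rfl⟩
    simpa [abs_mul, abs_of_pos t.2.1] using pow_le_one₀ t.2.1.le t.2.2.le⟩

theorem oscillatingGeometric_apply (t : Set.Ioo (0 : ℝ) 1) (n : ℕ) :
    (oscillatingGeometric t : ℕ → ℝ) n = (t : ℝ) ^ n.unpair.1 * (-1) ^ n.unpair.2 := rfl

theorem linearIndependent_geometric :
    LinearIndependent ℝ (fun (t : Set.Ioo (0 : ℝ) 1) (n : ℕ) => (t : ℝ) ^ n) := by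
  have h := (linearIndependent_monoidHom (Multiplicative ℕ) ℝ).comp
    (fun t : Set.Ioo (0 : ℝ) 1 => powersHom ℝ (t : ℝ))
    (fun s t hst => Subtype.ext ((powersHom ℝ).injective hst))
  exact h

theorem eq_zero_of_tendsto_mul_neg_one_pow {a l : ℝ}
    (h : Tendsto (fun k : ℕ => a * (-1) ^ k) atTop (𝓝 l)) : a = 0 := by
  have h1 := h.comp (tendsto_add_atTop_nat 1)
  have h2 : Tendsto (fun k : ℕ => a * (-1) ^ k) atTop (𝓝 (-l)) := by
    simpa [Function.comp_def, pow_succ] using h1.neg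
  have hl : l = 0 := by linarith [tendsto_nhds_unique h h2]
  have h3 := h.abs
  simp only [abs_mul, abs_pow, abs_neg, abs_one, one_pow, mul_one, hl, abs_zero] at h3
  exact abs_eq_zero.1 (tendsto_nhds_unique tendsto_const_nhds h3)

theorem linearIndependent_mkQ_oscillatingGeometric :
    LinearIndependent ℝ (fun t => convSubmodule.mkQ (oscillatingGeometric t)) := by
  rw [linearIndependent_iff']
  intro s g hg
  simp only [← map_smul, ← map_sum] at hg
  rw [Submodule.mkQ_apply, Submodule.Quotient.mk_eq_zero] at hg
  obtain ⟨l, hl⟩ := hg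
  refine linearIndependent_iff'.1 linearIndependent_geometric s g (funext fun i => ?_)
  have hpair : Tendsto (fun k => Nat.pair i k) atTop atTop :=
    tendsto_atTop_mono (fun k => Nat.right_le_pair i k) tendsto_id
  have hi := hl.comp hpair
  refine eq_zero_of_tendsto_mul_neg_one_pow (l := l) (hi.congr fun k => ?_)
  rw [Function.comp_apply, lp.coeFn_sum, Finset.sum_apply]
  simp [oscillatingGeometric_apply, Finset.sum_mul, mul_assoc]

theorem rank_quotient_convSubmodule :
    Module.rank ℝ (Linfty ⧸ convSubmodule) = Cardinal.continuum := by
  apply le_antisymm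
  · calc Module.rank ℝ (Linfty ⧸ convSubmodule)
        ≤ Module.rank ℝ Linfty := rank_quotient_le _
      _ ≤ Cardinal.mk Linfty := rank_le_card ℝ Linfty
      _ ≤ Cardinal.mk (ℕ → ℝ) := Cardinal.mk_le_of_injective
          (f := fun f : Linfty => (f : ℕ → ℝ)) fun _ _ h => lp.ext h
      _ = Cardinal.continuum := by simp [Cardinal.mk_real]
  · rw [← Cardinal.mk_Ioo_real zero_lt_one]
    exact linearIndependent_mkQ_oscillatingGeometric.cardinal_le_rank

/-- Every separable subspace `D ⊆ ℓ^∞` with `D ∩ c = {0}` is contained in a (not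
necessarily closed) subspace `Z` of algebraic dimension `𝔠` with `Z ∩ c = {0}`. -/
theorem stmt15 (D : Submodule ℝ Linfty)
    (hDsep : TopologicalSpace.IsSeparable (D : Set Linfty))
    (hDc : (D : Set Linfty) ∩ convSeq = {0}) :
    ∃ Z : Submodule ℝ Linfty, D ≤ Z ∧
      (Z : Set Linfty) ∩ convSeq = {0} ∧ Module.rank ℝ Z = Cardinal.continuum := by
  have hdisj : Disjoint D convSubmodule := by
    rw [Submodule.disjoint_def]
    intro x hx hxc
    have : x ∈ (D : Set Linfty) ∩ convSeq := ⟨hx, hxc⟩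
    rwa [hDc] at this
  obtain ⟨Z, hDZ, hZ⟩ := hdisj.exists_isCompl
  refine ⟨Z, hDZ, ?_, ?_⟩
  · refine Set.Subset.antisymm ?_ ?_
    · rintro x ⟨hxZ, hxc⟩
      exact Submodule.disjoint_def.1 hZ.disjoint x hxZ hxc
    · rintro _ rfl
      exact ⟨Z.zero_mem, convSubmodule.zero_mem⟩
  · rw [← rank_quotient_convSubmodule]
    exact (Submodule.quotientEquivOfIsCompl _ _ hZ.symm).rank_eq.symm
end
end
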